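/- Let F and G be proper filters in S, let s ∈ F and t ∈ G, and suppose d(F) ∩ E = d(G) ∩ E and there exists an idempotent e ∈ d(F) ∩ E with s·e = t·e. Then F = G. (The map from proper filters to proper germs, sending F to the germ [s, d(F) ∩ E] for any s ∈ F, is injective.) -/

import Mathlib

/-- An inverse semigroup with zero: every element `a` has a unique `a⁻¹` with
`a * a⁻¹ * a = a` and `a⁻¹ * a * a⁻¹ = a⁻¹`, and `0` is absorbing. -/
class InvSemigroupWithZero (S : Type*) extends Semigroup S, Zero S, Inv S where
  mul_inv_mul : ∀ a : S, a * a⁻¹ * a = a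
  inv_mul_inv : ∀ a : S, a⁻¹ * a * a⁻¹ = a⁻¹
  inv_unique : ∀ a b : S, a * b * a = a → b * a * b = b → b = a⁻¹
  zero_mul : ∀ a : S, 0 * a = 0
  mul_zero : ∀ a : S, a * 0 = 0

namespace InvSemigroupWithZero

variable {S : Type*} [InvSemigroupWithZero S]

/-- The natural partial order on `S`: `a ≤ b` iff `a = a * a⁻¹ * b`. -/
def sle (a b : S) : Prop := a = a * a⁻¹ * b

/-- `↓s`, the down-set of `s` w.r.t. the natural partial order. -/
def dwn (s : S) : Set S := {t : S | sle t s}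

/-- `↑A`, the up-set generated by `A` w.r.t. the natural partial order. -/
def up (A : Set S) : Set S := {b : S | ∃ a ∈ A, sle a b}

/-- A filter in `S`: a nonempty down-directed up-set. -/
def IsFilt (F : Set S) : Prop :=
  F.Nonempty ∧ up F = F ∧ ∀ a ∈ F, ∀ b ∈ F, ∃ c ∈ F, sle c a ∧ sle c b

/-- A proper filter: a filter not containing `0`. -/
def IsPFilt (F : Set S) : Prop := IsFilt F ∧ (0 : S) ∉ F

/-- An ultrafilter: a proper filter maximal among proper filters. -/
def IsUltra (U : Set S) : Prop :=
  IsPFilt U ∧ ∀ G : Set S, IsPFilt G → U ⊆ G → U = G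

/-- The set `E` of idempotents of `S`. -/
def E (S : Type*) [InvSemigroupWithZero S] : Set S := {e : S | e * e = e}

/-- `F⁻¹ = {a⁻¹ : a ∈ F}`. -/
def finv (F : Set S) : Set S := (fun a : S => a⁻¹) '' F

/-- `F · G = ↑{fg : f ∈ F, g ∈ G}`. -/
def fmul (F G : Set S) : Set S := up (Set.image2 (· * ·) F G)

/-- The source `d(F) := F⁻¹ · F`. -/
def src (F : Set S) : Set S := fmul (finv F) F

/-- The range `r(F) := F · F⁻¹`. -/
def rng (F : Set S) : Set S := fmul F (finv F)

/-- The natural partial order on the idempotents: `e ≤ f` iff `e = e * f`. -/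
def ele (e f : S) : Prop := e = e * f

/-- The down-set of an idempotent `e` inside `E`. -/
def edwn (e : S) : Set S := {f : S | f ∈ E S ∧ ele f e}

/-- The up-set generated by `A` inside `E`. -/
def eup (A : Set S) : Set S := {f : S | f ∈ E S ∧ ∃ a ∈ A, ele a f}

/-- An `E`-filter: a proper filter of the inverse semigroup `E` of idempotents. -/
def IsEFilt (ξ : Set S) : Prop :=
  ξ ⊆ E S ∧ ξ.Nonempty ∧ eup ξ = ξ ∧
    (∀ a ∈ ξ, ∀ b ∈ ξ, ∃ c ∈ ξ, ele c a ∧ ele c b) ∧ (0 : S) ∉ ξ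

/-- An `E`-ultrafilter: an `E`-filter maximal among `E`-filters. -/
def IsEUltra (ξ : Set S) : Prop :=
  IsEFilt ξ ∧ ∀ η : Set S, IsEFilt η → ξ ⊆ η → ξ = η

/-- `β_s(ξ) = {f ∈ E : s·e·s⁻¹ ≤ f for some e ∈ ξ}`. -/
def beta (s : S) (ξ : Set S) : Set S :=
  {f : S | f ∈ E S ∧ ∃ e ∈ ξ, sle (s * e * s⁻¹) f}

/-- The set of proper filters in `S`. -/
abbrev PFilt (S : Type*) [InvSemigroupWithZero S] := {F : Set S // IsPFilt F}

/-- The patch topology on the set of proper filters, generated by the sets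
`F(s;T) = {F : s ∈ F, F ∩ T = ∅}` for `s ∈ S` and finite `T ⊆ ↓s`. -/
instance patchTopology : TopologicalSpace (PFilt S) :=
  TopologicalSpace.generateFrom
    {O : Set (PFilt S) | ∃ (s : S) (T : Set S), T.Finite ∧ T ⊆ dwn s ∧
      O = {F : PFilt S | s ∈ F.1 ∧ F.1 ∩ T = ∅}}

/-- The set of idempotent proper filters in `S`. -/
abbrev IPFilt (S : Type*) [InvSemigroupWithZero S] :=
  {F : Set S // IsPFilt F ∧ (F ∩ E S).Nonempty}

/-- The subspace topology induced by the patch topology on proper filters. -/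
instance : TopologicalSpace (IPFilt S) :=
  TopologicalSpace.induced (fun F => (⟨F.1, F.2.1⟩ : PFilt S)) inferInstance

/-- The set of `E`-filters. -/
abbrev EFilt (S : Type*) [InvSemigroupWithZero S] := {ξ : Set S // IsEFilt ξ}

/-- The patch topology on the set of `E`-filters, generated by the sets
`P(e;X) = {ξ : e ∈ ξ, ξ ∩ X = ∅}` for `e ∈ E` and finite `X ⊆ ↓e ∩ E`. -/
instance : TopologicalSpace (EFilt S) :=
  TopologicalSpace.generateFrom
    {O : Set (EFilt S) | ∃ (e : S) (X : Set S), e ∈ E S ∧ X.Finite ∧ X ⊆ edwn e ∧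
      O = {ξ : EFilt S | e ∈ ξ.1 ∧ ξ.1 ∩ X = ∅}}

/-- The set of ultrafilters in `S`. -/
abbrev UFilt (S : Type*) [InvSemigroupWithZero S] := {U : Set S // IsUltra U}

/-- The subspace topology induced by the patch topology on proper filters. -/
instance : TopologicalSpace (UFilt S) :=
  TopologicalSpace.induced (fun U => (⟨U.1, U.2.1⟩ : PFilt S)) inferInstance

end InvSemigroupWithZero

open InvSemigroupWithZero

namespace InvSemigroupWithZero

variable {S : Type*} [InvSemigroupWithZero S]

theorem inv_eq_self {e : S} (he : e * e = e) : e⁻¹ = e :=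
  (inv_unique e e (by rw [he, he]) (by rw [he, he])).symm

theorem inv_inv_eq (a : S) : a⁻¹⁻¹ = a :=
  (inv_unique a⁻¹ a (inv_mul_inv a) (mul_inv_mul a)).symm

theorem mul_inv_idem (a : S) : a * a⁻¹ * (a * a⁻¹) = a * a⁻¹ := by
  rw [← mul_assoc, mul_inv_mul]

theorem inv_mul_idem (a : S) : a⁻¹ * a * (a⁻¹ * a) = a⁻¹ * a := by
  rw [← mul_assoc, inv_mul_inv]

theorem idem_mul_idem {e f : S} (he : e * e = e) (hf : f * f = f) :
    e * f * (e * f) = e * f := by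
  have h1 := mul_inv_mul (e * f)
  have h2 := inv_mul_inv (e * f)
  have hx : f * (e * f)⁻¹ * e = (e * f)⁻¹ := by
    apply inv_unique
    · calc e * f * (f * (e * f)⁻¹ * e) * (e * f)
          = e * (f * f) * (e * f)⁻¹ * ((e * e) * f) := by simp only [mul_assoc]
        _ = e * f := by rw [he, hf, h1]
    · calc f * (e * f)⁻¹ * e * (e * f) * (f * (e * f)⁻¹ * e)
          = f * ((e * f)⁻¹ * ((e * e) * (f * f)) * (e * f)⁻¹) * e := by simp only [mul_assoc]
        _ = f * (e * f)⁻¹ * e := by rw [he, hf, h2]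
  have hi : (e * f)⁻¹ * (e * f)⁻¹ = (e * f)⁻¹ := by
    calc (e * f)⁻¹ * (e * f)⁻¹
        = (f * (e * f)⁻¹ * e) * (f * (e * f)⁻¹ * e) := by rw [hx]
      _ = f * ((e * f)⁻¹ * (e * f) * (e * f)⁻¹) * e := by simp only [mul_assoc]
      _ = (e * f)⁻¹ := by rw [h2, hx]
  have h3 := inv_eq_self hi
  rw [inv_inv_eq] at h3
  rw [← h3] at hi
  exact hi

theorem idem_comm {e f : S} (he : e * e = e) (hf : f * f = f) : e * f = f * e := by
  have h1 := idem_mul_idem he hf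
  have h2 := idem_mul_idem hf he
  rw [← inv_eq_self h1]
  symm
  apply inv_unique
  · calc e * f * (f * e) * (e * f) = e * (f * f) * ((e * e) * f) := by simp only [mul_assoc]
      _ = e * f := by rw [he, hf, h1]
  · calc f * e * (e * f) * (f * e) = f * (e * e) * ((f * f) * e) := by simp only [mul_assoc]
      _ = f * e := by rw [he, hf, h2]

theorem mul_inv_eq (a b : S) : (a * b)⁻¹ = b⁻¹ * a⁻¹ := by
  symm
  have hc := idem_comm (inv_mul_idem a) (mul_inv_idem b)
  apply inv_unique
  · calc a * b * (b⁻¹ * a⁻¹) * (a * b)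
        = a * ((b * b⁻¹) * (a⁻¹ * a)) * b := by simp only [mul_assoc]
      _ = (a * a⁻¹ * a) * (b * b⁻¹ * b) := by rw [← hc]; simp only [mul_assoc]
      _ = a * b := by rw [mul_inv_mul, mul_inv_mul]
  · calc b⁻¹ * a⁻¹ * (a * b) * (b⁻¹ * a⁻¹)
        = b⁻¹ * ((a⁻¹ * a) * (b * b⁻¹)) * a⁻¹ := by simp only [mul_assoc]
      _ = (b⁻¹ * b * b⁻¹) * (a⁻¹ * a * a⁻¹) := by rw [hc]; simp only [mul_assoc]
      _ = b⁻¹ * a⁻¹ := by rw [inv_mul_inv, inv_mul_inv]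

theorem idem_mul_sle {e : S} (he : e * e = e) (b : S) : sle (e * b) b := by
  unfold sle
  rw [mul_inv_eq, inv_eq_self he]
  symm
  calc e * b * (b⁻¹ * e) * b = e * ((b * b⁻¹) * e) * b := by simp only [mul_assoc]
    _ = (e * e) * (b * b⁻¹ * b) := by
      rw [← idem_comm he (mul_inv_idem b)]; simp only [mul_assoc]
    _ = e * b := by rw [he, mul_inv_mul]

theorem sle.eq_mul {a b : S} (h : sle a b) : a = b * (a⁻¹ * a) := by
  symm
  calc b * (a⁻¹ * a) = b * ((a * a⁻¹ * b)⁻¹ * (a * a⁻¹ * b)) := by rw [← h]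
    _ = (b * b⁻¹) * (a * a⁻¹) * (a * a⁻¹) * b := by
      rw [mul_inv_eq, inv_eq_self (mul_inv_idem a)]; simp only [mul_assoc]
    _ = (a * a⁻¹) * (a * a⁻¹) * (b * b⁻¹ * b) := by
      rw [idem_comm (mul_inv_idem b) (mul_inv_idem a), mul_assoc (a * a⁻¹),
        idem_comm (mul_inv_idem b) (mul_inv_idem a)]
      simp only [mul_assoc]
    _ = a := by rw [mul_inv_mul, mul_inv_idem, ← h]

theorem mul_idem_sle {e : S} (he : e * e = e) (b : S) : sle (b * e) b := by
  have hi : b * e * b⁻¹ * (b * e * b⁻¹) = b * e * b⁻¹ := by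
    calc b * e * b⁻¹ * (b * e * b⁻¹) = b * (e * (b⁻¹ * b)) * e * b⁻¹ := by
          simp only [mul_assoc]
      _ = (b * b⁻¹ * b) * (e * e) * b⁻¹ := by
          rw [idem_comm he (inv_mul_idem b)]; simp only [mul_assoc]
      _ = b * e * b⁻¹ := by rw [mul_inv_mul, he]
  have h : b * e = b * e * b⁻¹ * b := by
    symm
    calc b * e * b⁻¹ * b = b * (e * (b⁻¹ * b)) := by simp only [mul_assoc]
      _ = (b * b⁻¹ * b) * e := by
          rw [idem_comm he (inv_mul_idem b)]; simp only [mul_assoc]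
      _ = b * e := by rw [mul_inv_mul]
  rw [h]
  exact idem_mul_sle hi b

theorem sle.trans {a b c : S} (hab : sle a b) (hbc : sle b c) : sle a c := by
  have h : a = (a * a⁻¹) * (b * b⁻¹) * c := by
    rw [mul_assoc, ← hbc]; exact hab
  rw [h]
  exact idem_mul_sle (idem_mul_idem (mul_inv_idem a) (mul_inv_idem b)) c

theorem sle.inv {a b : S} (h : sle a b) : sle a⁻¹ b⁻¹ := by
  have h' : a⁻¹ = b⁻¹ * (a * a⁻¹) := by
    conv_lhs => rw [h, mul_inv_eq, inv_eq_self (mul_inv_idem a)]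
  rw [h']
  exact mul_idem_sle (mul_inv_idem a) _

theorem sle.mul {a b c d : S} (hab : sle a b) (hcd : sle c d) : sle (a * c) (b * d) := by
  have h : a * c = (a * a⁻¹) * (b * d * (c⁻¹ * c)) := by
    calc a * c = (a * a⁻¹ * b) * (d * (c⁻¹ * c)) := by rw [← hab, ← hcd.eq_mul]
      _ = _ := by simp only [mul_assoc]
  rw [h]
  exact (idem_mul_sle (mul_inv_idem a) _).trans (mul_idem_sle (inv_mul_idem c) _)

theorem sle.inv_mul_mul_eq {c f : S} (h : sle (c⁻¹ * c) f) : c⁻¹ * c * f = c⁻¹ * c := by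
  have h' : c⁻¹ * c = c⁻¹ * c * (c⁻¹ * c)⁻¹ * f := h
  rw [inv_eq_self (inv_mul_idem c), inv_mul_idem] at h'
  exact h'.symm

theorem IsFilt.mem_of_sle {F : Set S} (hF : IsFilt F) {a b : S} (ha : a ∈ F)
    (hab : sle a b) : b ∈ F := by
  rw [← hF.2.1]
  exact ⟨a, ha, hab⟩

theorem inv_mul_mem_src {F : Set S} (hF : IsFilt F) {c : S} (hc : c ∈ F) :
    c⁻¹ * c ∈ src F := by
  obtain ⟨d, hd, hdc, -⟩ := hF.2.2 c hc c hc
  exact ⟨d⁻¹ * d, ⟨d⁻¹, ⟨d, hd, rfl⟩, d, hd, rfl⟩, hdc.inv.mul hdc⟩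

/-- Each element of `d(F)` lies above `c⁻¹ * c` for some `c ∈ F` below any given element
of `F`. -/
theorem exists_inv_mul_sle {F : Set S} (hF : IsFilt F) {a e : S} (ha : a ∈ F)
    (he : e ∈ src F) : ∃ c ∈ F, sle c a ∧ sle (c⁻¹ * c) e := by
  obtain ⟨_, ⟨_, ⟨x, hx, rfl⟩, y, hy, rfl⟩, hxy⟩ := he
  obtain ⟨p, hp, hpx, hpy⟩ := hF.2.2 x hx y hy
  obtain ⟨c, hc, hca, hcp⟩ := hF.2.2 a ha p hp
  exact ⟨c, hc, hca, ((hcp.trans hpx).inv.mul (hcp.trans hpy)).trans hxy⟩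

theorem mul_mem_of_mem_src {G : Set S} (hG : IsFilt G) {t f : S} (ht : t ∈ G)
    (hf : f ∈ src G) : t * f ∈ G := by
  obtain ⟨d, hd, hdt, hdf⟩ := exists_inv_mul_sle hG ht hf
  refine hG.mem_of_sle hd ?_
  have h : d * f = d := by
    calc d * f = d * (d⁻¹ * d * f) := by
          conv_lhs => rw [← mul_inv_mul d]
          simp only [mul_assoc]
      _ = d := by rw [hdf.inv_mul_mul_eq, ← mul_assoc, mul_inv_mul]
  calc d = d * f := h.symm
    _ = d * d⁻¹ * t * f := by rw [← hdt]
    _ = d * d⁻¹ * (t * f) := mul_assoc _ _ _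

theorem subset_of_germ_eq {F G : Set S} (hF : IsFilt F) (hG : IsFilt G) {s t e : S}
    (hs : s ∈ F) (ht : t ∈ G) (hE : src F ∩ E S ⊆ src G ∩ E S)
    (he : e ∈ src F ∩ E S) (hst : s * e = t * e) : F ⊆ G := by
  intro a ha
  obtain ⟨b, hb, hba, hbs⟩ := hF.2.2 a ha s hs
  obtain ⟨c, hc, hcb, hce⟩ := exists_inv_mul_sle hF hb he.1
  have hf := hE ⟨inv_mul_mem_src hF hc, inv_mul_idem c⟩
  have hfe : e * (c⁻¹ * c) = c⁻¹ * c := by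
    rw [idem_comm he.2 (inv_mul_idem c), hce.inv_mul_mul_eq]
  have h : t * (c⁻¹ * c) = c := by
    rw [← hfe, ← mul_assoc, ← hst, mul_assoc, hfe]
    exact ((hcb.trans hbs).eq_mul).symm
  have hcG := mul_mem_of_mem_src hG ht hf.1
  rw [h] at hcG
  exact hG.mem_of_sle hcG (hcb.trans hba)

end InvSemigroupWithZero

/-- If `F, G` are proper filters, `s ∈ F`, `t ∈ G`,
`d(F) ∩ E = d(G) ∩ E`, and `s·e = t·e` for some idempotent `e ∈ d(F) ∩ E`, then `F = G`
(the filters-to-germs map is injective). -/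
theorem stmt_14 {S : Type*} [InvSemigroupWithZero S]
    (F G : Set S) (hF : IsPFilt F) (hG : IsPFilt G)
    (s t : S) (hs : s ∈ F) (ht : t ∈ G)
    (hE : src F ∩ E S = src G ∩ E S)
    (he : ∃ e ∈ src F ∩ E S, s * e = t * e) : F = G := by
  obtain ⟨e, he, hst⟩ := he
  exact (subset_of_germ_eq hF.1 hG.1 hs ht hE.subset he hst).antisymm
    (subset_of_germ_eq hG.1 hF.1 ht hs hE.superset (hE ▸ he) hst.symm)
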